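/- There exists N such that for all n ≥ N and every p with 48²(log n)⁷/n ≤ p ≤ 1 − 36·n^{−1/2}(log n)^{7/2}, the random graph G ~ G_{n,p} is strongly 2-jumping with probability at least 1 − 6/log n. -/

import Mathlib

open scoped Classical
open SimpleGraph

namespace EDHC

/-- Degree of a vertex (as cardinality of its neighbour set). -/
noncomputable def deg {V : Type} (G : SimpleGraph V) (v : V) : ℕ := (G.neighborSet v).ncard

/-- Minimum degree. -/
noncomputable def minDeg {V : Type} (G : SimpleGraph V) : ℕ := sInf (Set.range (deg G))

/-- Maximum degree. -/
noncomputable def maxDeg {V : Type} (G : SimpleGraph V) : ℕ := sSup (Set.range (deg G))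

/-- Number of edges of `G` with both endpoints in `S`. -/
noncomputable def eIn {V : Type} (G : SimpleGraph V) (S : Set V) : ℕ :=
  {e ∈ G.edgeSet | ∀ v ∈ e, v ∈ S}.ncard

/-- Number of edges of `G` with one endpoint in `S` and the other in `T`. -/
noncomputable def eBtw {V : Type} (G : SimpleGraph V) (S T : Set V) : ℕ :=
  {e ∈ G.edgeSet | ∃ a ∈ S, ∃ b ∈ T, e = s(a, b)}.ncard

/-- `G` is `(p, β)`-jumbled. -/
def IsJumbled {V : Type} (G : SimpleGraph V) (p β : ℝ) : Prop :=
  ∀ S : Set V, |(eIn G S : ℝ) - p * ((S.ncard : ℝ) * ((S.ncard : ℝ) - 1) / 2)| ≤ β * S.ncard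

/-- `G` is strongly `2`-jumping. -/
def StronglyTwoJumping (n : ℕ) (G : SimpleGraph (Fin n)) : Prop :=
  ∀ T : Set (Fin n), T.Nonempty →
    (∑ v ∈ (Set.toFinite T).toFinset, (deg G v : ℝ)) / (T.ncard : ℝ) ≥
      (minDeg G : ℝ) + min ((T.ncard : ℝ) - 1) ((Real.log n) ^ 2)

/-- `G` is `p`-pseudorandom. -/
def IsPseudorandom (n : ℕ) (G : SimpleGraph (Fin n)) (p : ℝ) : Prop :=
  IsJumbled G p (2 * Real.sqrt (n * p * (1 - p))) ∧
  (∀ S T : Set (Fin n), Disjoint S T →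
    ((1 / (S.ncard : ℝ) + 1 / (T.ncard : ℝ)) * Real.log n / p ≥ 7 / 2 →
      (eBtw G S T : ℝ) ≤ 2 * ((S.ncard : ℝ) + (T.ncard : ℝ)) * Real.log n) ∧
    ((1 / (S.ncard : ℝ) + 1 / (T.ncard : ℝ)) * Real.log n / p ≤ 7 / 2 →
      (eBtw G S T : ℝ) ≤ 7 * (S.ncard : ℝ) * (T.ncard : ℝ) * p)) ∧
  (∀ S : Set (Fin n),
    (Real.log n / ((S.ncard : ℝ) * p) ≥ 7 / 4 → (eIn G S : ℝ) ≤ 2 * (S.ncard : ℝ) * Real.log n) ∧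
    (Real.log n / ((S.ncard : ℝ) * p) ≤ 7 / 4 → (eIn G S : ℝ) ≤ 7 * (S.ncard : ℝ) ^ 2 * p / 2)) ∧
  ((n : ℝ) * p - 2 * Real.sqrt ((n : ℝ) * p * Real.log n) ≤ (minDeg G : ℝ) ∧
    (minDeg G : ℝ) ≤ (n : ℝ) * p - 200 * Real.sqrt ((n : ℝ) * p * (1 - p)) ∧
    (maxDeg G : ℝ) ≤ (n : ℝ) * p + 2 * Real.sqrt ((n : ℝ) * p * Real.log n)) ∧
  StronglyTwoJumping n G

/-- `G` is `u`-jumping. -/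
def IsJumping (n : ℕ) (G : SimpleGraph (Fin n)) (u : ℝ) : Prop :=
  ∃ x₀ : Fin n, deg G x₀ = minDeg G ∧
    ∀ x : Fin n, x ≠ x₀ → (deg G x : ℝ) ≥ (minDeg G : ℝ) + u

/-- `C` is a Hamilton cycle (on the whole vertex set `Fin n`). -/
def IsHamCycle {n : ℕ} (C : SimpleGraph (Fin n)) : Prop :=
  ∃ (v : Fin n) (w : C.Walk v v), w.IsHamiltonianCycle ∧ C.edgeSet = {e | e ∈ w.edges}

/-- `G` has property `H`. -/
def HasPropertyH (n : ℕ) (G : SimpleGraph (Fin n)) : Prop :=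
  ∃ HC : Fin (minDeg G / 2) → SimpleGraph (Fin n),
    (∀ i, HC i ≤ G ∧ IsHamCycle (HC i)) ∧
    (∀ i j, i ≠ j → Disjoint (HC i).edgeSet (HC j).edgeSet) ∧
    (Odd (minDeg G) →
      ∃ M : SimpleGraph (Fin n), M ≤ G ∧ (∀ v, deg M v ≤ 1) ∧
        M.edgeSet.ncard = n / 2 ∧ ∀ i, Disjoint M.edgeSet (HC i).edgeSet)

/-- Probability of the event `A` under the binomial random graph `G_{n,p}`. -/
noncomputable def gnpProb (n : ℕ) (p : ℝ) (A : SimpleGraph (Fin n) → Prop) : ℝ :=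
  ∑ G : SimpleGraph (Fin n),
    if A G then p ^ G.edgeSet.ncard * (1 - p) ^ (n.choose 2 - G.edgeSet.ncard) else 0


/-- Number of cycles of a 2-regular graph = number of connected components. -/
noncomputable def numCycles {V : Type} (F : SimpleGraph V) : ℕ := Nat.card F.ConnectedComponent

/-- `N` is a perfect matching on the whole vertex set. -/
def IsPerfectMatchingGraph {n : ℕ} (N : SimpleGraph (Fin n)) : Prop :=
  ∀ v, ((N.neighborSet v).ncard) = 1

/-- `N` is a perfect pseudomatching: one vertex of degree 2, all others of degree 1. -/
def IsPerfectPseudomatching {n : ℕ} (N : SimpleGraph (Fin n)) : Prop :=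
  ∃ w, ((N.neighborSet w).ncard) = 2 ∧ ∀ v, v ≠ w → ((N.neighborSet v).ncard) = 1

/-- A set of edges forms a matching (no two distinct edges share a vertex). -/
def IsMatchingSet {n : ℕ} (E : Set (Sym2 (Fin n))) : Prop :=
  ∀ e ∈ E, ∀ f ∈ E, e ≠ f → ∀ v : Fin n, v ∈ e → v ∉ f

/-- Number of cycles (orbits, including fixed points) of a permutation. -/
noncomputable def cycleCount {α : Type} (σ : Equiv.Perm α) : ℕ :=
  Nat.card (Quotient (⟨σ.SameCycle,
    ⟨fun x => Equiv.Perm.SameCycle.refl σ x, fun h => h.symm, fun h h' => h.trans h'⟩⟩ : Setoid α))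

/-- Edges of the bipartite graph given by the relation `R` between `S` and `T`. -/
noncomputable def eBip {n : ℕ} (R : Fin n → Fin n → Prop) (S T : Set (Fin n)) : ℕ :=
  {q : Fin n × Fin n | q.1 ∈ S ∧ q.2 ∈ T ∧ R q.1 q.2}.ncard

/-- One rotation of a path (represented as a list of vertices), with new edge from `H`
and pivot in `Q`. -/
def RotStep {V : Type} (H : SimpleGraph V) (Q : Set V) (l l' : List V) : Prop :=
  ∃ (x : V) (a : List V) (p : V) (b : List V),
    l = (x :: a) ++ p :: b ∧ l' = (x :: a).reverse ++ p :: b ∧ p ∈ Q ∧ H.Adj x p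

/-- `v` is `(H, Q, τ)`-reachable from the path `l`. -/
def ReachableVert {V : Type} (H : SimpleGraph V) (Q : Set V) (τ : ℕ) (l : List V) (v : V) : Prop :=
  ∃ (k : ℕ) (f : ℕ → List V), k ≤ τ ∧ f 0 = l ∧
    (∀ i < k, RotStep H Q (f i) (f (i + 1))) ∧ (f k).head? = some v

/-- External neighbourhood. -/
def extNbhd {V : Type} (H : SimpleGraph V) (S : Set V) : Set V :=
  (⋃ x ∈ S, H.neighborSet x) \ S


lemma deg_eq_degree {V : Type} [Fintype V] (G : SimpleGraph V) (v : V) :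
    deg G v = G.degree v := by
  rw [deg, Set.ncard_eq_toFinset_card', SimpleGraph.degree, SimpleGraph.neighborFinset]

/-- The weight of a single graph in the binomial random graph model. -/
noncomputable def gnpWeight (n : ℕ) (p : ℝ) (G : SimpleGraph (Fin n)) : ℝ :=
  p ^ G.edgeSet.ncard * (1 - p) ^ (n.choose 2 - G.edgeSet.ncard)

lemma gnpWeight_nonneg {n : ℕ} {p : ℝ} (h0 : 0 ≤ p) (h1 : p ≤ 1) (G : SimpleGraph (Fin n)) :
    0 ≤ gnpWeight n p G :=
  mul_nonneg (pow_nonneg h0 _) (pow_nonneg (sub_nonneg.2 h1) _)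

/-- Expansion of a product over all possible edges as a sum over graphs. -/
lemma sum_graph_prod {n : ℕ} (f g : Sym2 (Fin n) → ℝ) :
    ∑ G : SimpleGraph (Fin n), (∏ e ∈ G.edgeFinset, f e) *
      ∏ e ∈ (⊤ : SimpleGraph (Fin n)).edgeFinset \ G.edgeFinset, g e =
    ∏ e ∈ (⊤ : SimpleGraph (Fin n)).edgeFinset, (f e + g e) := by
  rw [Finset.prod_add]
  refine Finset.sum_nbij' (fun G => G.edgeFinset) (fun s => SimpleGraph.fromEdgeSet (s : Set (Sym2 (Fin n))))
    ?_ ?_ ?_ ?_ ?_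
  · intro G _
    simp only [Finset.mem_powerset]
    exact SimpleGraph.edgeFinset_mono le_top
  · intro s _
    simp
  · intro G _
    simp
  · intro s hs
    ext e
    rw [Finset.mem_powerset] at hs
    simp only [SimpleGraph.mem_edgeFinset, SimpleGraph.edgeSet_fromEdgeSet, Set.mem_sdiff,
      Finset.mem_coe]
    constructor
    · exact fun h => h.1
    · intro h
      have := hs h
      simp at this
      exact ⟨h, this⟩
  · intro G _
    rfl

lemma gnpWeight_eq_prod {n : ℕ} (p : ℝ) (G : SimpleGraph (Fin n)) :
    gnpWeight n p G = (∏ _e ∈ G.edgeFinset, p) *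
      ∏ _e ∈ (⊤ : SimpleGraph (Fin n)).edgeFinset \ G.edgeFinset, (1 - p) := by
  have hc : (⊤ : SimpleGraph (Fin n)).edgeFinset.card = n.choose 2 := by
    rw [SimpleGraph.card_edgeFinset_top_eq_card_choose_two, Fintype.card_fin]
  rw [Finset.prod_const, Finset.prod_const,
    Finset.card_sdiff_of_subset (SimpleGraph.edgeFinset_mono le_top), hc, gnpWeight,
    Set.ncard_eq_toFinset_card', SimpleGraph.edgeFinset]

lemma card_filter_mem_edgeFinset {V : Type} [Fintype V] (G : SimpleGraph V) (v : V)
    [Fintype G.edgeSet] [DecidablePred (v ∈ · : Sym2 V → Prop)] :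
    (G.edgeFinset.filter (v ∈ ·)).card = deg G v := by
  rw [deg_eq_degree, ← SimpleGraph.card_incidenceFinset_eq_degree,
    SimpleGraph.incidenceFinset_eq_filter]
  congr!

/-- The moment generating function of the degree of a vertex. -/
lemma sum_gnpWeight_mul_exp_deg (n : ℕ) (p l : ℝ) (v : Fin n) :
    ∑ G : SimpleGraph (Fin n), gnpWeight n p G * Real.exp (l * deg G v) =
      (p * Real.exp l + (1 - p)) ^ (n - 1) := by
  have h := sum_graph_prod (n := n)
    (fun e => p * if v ∈ e then Real.exp l else 1) (fun _ => 1 - p)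
  have hR : ∏ e ∈ (⊤ : SimpleGraph (Fin n)).edgeFinset,
      ((p * if v ∈ e then Real.exp l else 1) + (1 - p)) =
      (p * Real.exp l + (1 - p)) ^ (n - 1) := by
    have : ∀ e : Sym2 (Fin n), ((p * if v ∈ e then Real.exp l else 1) + (1 - p)) =
        if v ∈ e then p * Real.exp l + (1 - p) else 1 := by
      intro e; split_ifs <;> ring
    simp_rw [this]
    rw [← Finset.prod_filter, Finset.prod_const, card_filter_mem_edgeFinset, deg_eq_degree]
    congr 1
    have h := SimpleGraph.complete_graph_degree v
    rw [Fintype.card_fin] at h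
    rw [← h]
    congr!
  rw [← hR, ← h]
  refine Finset.sum_congr rfl fun G _ => ?_
  rw [gnpWeight_eq_prod, Finset.prod_mul_distrib, ← Finset.prod_filter, Finset.prod_const (Real.exp l),
    card_filter_mem_edgeFinset, mul_comm l, Real.exp_nat_mul]
  ring

lemma sum_gnpWeight {n : ℕ} (hn : 0 < n) (p : ℝ) :
    ∑ G : SimpleGraph (Fin n), gnpWeight n p G = 1 := by
  have := sum_gnpWeight_mul_exp_deg n p 0 ⟨0, hn⟩
  simpa using this

lemma bernoulli_mgf_le {p l : ℝ} (h0 : 0 ≤ p) (h1 : p ≤ 1) (hl : |l| ≤ 1) :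
    p * Real.exp l + (1 - p) ≤ Real.exp (l * p + l ^ 2 * (p * (1 - p))) := by
  have key : ∀ x : ℝ, |x| ≤ 1 → Real.exp x ≤ 1 + x + x ^ 2 := by
    intro x hx
    have := abs_le.1 (Real.abs_exp_sub_one_sub_id_le hx)
    linarith [this.2]
  have hq : 0 ≤ 1 - p := by linarith
  have e1 := key (l * (1 - p)) (by
    rw [abs_mul, abs_of_nonneg hq]; nlinarith [abs_nonneg l])
  have e2 := key (-(l * p)) (by
    rw [abs_neg, abs_mul, abs_of_nonneg h0]; nlinarith [abs_nonneg l])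
  have e3 := Real.add_one_le_exp (l ^ 2 * (p * (1 - p)))
  have e4 : p * Real.exp l + (1 - p) =
      Real.exp (l * p) * (p * Real.exp (l * (1 - p)) + (1 - p) * Real.exp (-(l * p))) := by
    rw [mul_add, mul_left_comm, mul_left_comm _ (1 - p), ← Real.exp_add, ← Real.exp_add]
    ring_nf
    rw [Real.exp_zero]
    ring
  rw [e4, Real.exp_add]
  refine mul_le_mul_of_nonneg_left ?_ (Real.exp_nonneg _)
  nlinarith [mul_le_mul_of_nonneg_left e1 h0, mul_le_mul_of_nonneg_left e2 hq]

/-- A one-sided Chernoff bound; the sign of `l` selects the tail. -/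
lemma sum_gnpWeight_deg_tail {n : ℕ} {p l r : ℝ} (h0 : 0 ≤ p) (h1 : p ≤ 1) (hl : |l| ≤ 1)
    (v : Fin n) :
    ∑ G : SimpleGraph (Fin n),
      (if |l| * r ≤ l * ((deg G v : ℝ) - n * p) then gnpWeight n p G else 0) ≤
      Real.exp (1 + l ^ 2 * (n * p * (1 - p)) - |l| * r) := by
  have hn : 1 ≤ n := by have := v.2; omega
  calc _ ≤ ∑ G : SimpleGraph (Fin n), (gnpWeight n p G * Real.exp (l * deg G v)) *
        Real.exp (- (l * (n * p)) - |l| * r) := by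
        refine Finset.sum_le_sum fun G _ => ?_
        have hw := gnpWeight_nonneg h0 h1 G
        rw [mul_assoc, ← Real.exp_add]
        split_ifs with h
        · exact le_mul_of_one_le_right hw (Real.one_le_exp (by linarith))
        · positivity
    _ = (p * Real.exp l + (1 - p)) ^ (n - 1) * Real.exp (- (l * (n * p)) - |l| * r) := by
        rw [← Finset.sum_mul, sum_gnpWeight_mul_exp_deg]
    _ ≤ Real.exp (l * p + l ^ 2 * (p * (1 - p))) ^ (n - 1) *
          Real.exp (- (l * (n * p)) - |l| * r) := by
        have hq : 0 ≤ 1 - p := by linarith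
        gcongr
        exact bernoulli_mgf_le h0 h1 hl
    _ ≤ _ := by
        rw [← Real.exp_nat_mul, ← Real.exp_add, Nat.cast_sub hn]
        refine Real.exp_le_exp.2 ?_
        have hlp : -l * p ≤ 1 := by
          have := neg_le_abs l
          nlinarith [abs_nonneg l]
        have : 0 ≤ l ^ 2 * (p * (1 - p)) :=
          mul_nonneg (sq_nonneg _) (mul_nonneg h0 (by linarith))
        push_cast
        nlinarith

/-- With high probability all degrees are close to `n * p`. -/
lemma sum_gnpWeight_deg_far {n : ℕ} {p l r : ℝ} (h0 : 0 ≤ p) (h1 : p ≤ 1) (hl0 : 0 < l)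
    (hl1 : l ≤ 1) :
    ∑ G : SimpleGraph (Fin n),
      (if ∀ v, |(deg G v : ℝ) - n * p| ≤ r then 0 else gnpWeight n p G) ≤
      2 * n * Real.exp (1 + l ^ 2 * (n * p * (1 - p)) - l * r) := by
  have habs : |l| = l := abs_of_pos hl0
  have key : ∀ G : SimpleGraph (Fin n),
      (if ∀ v, |(deg G v : ℝ) - n * p| ≤ r then 0 else gnpWeight n p G) ≤
      ∑ v : Fin n, ((if |l| * r ≤ l * ((deg G v : ℝ) - n * p) then gnpWeight n p G else 0) +
        (if |(-l)| * r ≤ (-l) * ((deg G v : ℝ) - n * p) then gnpWeight n p G else 0)) := by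
    intro G
    have hw := gnpWeight_nonneg h0 h1 G
    have hnn : ∀ v ∈ (Finset.univ : Finset (Fin n)),
      0 ≤ ((if |l| * r ≤ l * ((deg G v : ℝ) - n * p) then gnpWeight n p G else 0) +
        (if |(-l)| * r ≤ (-l) * ((deg G v : ℝ) - n * p) then gnpWeight n p G else 0)) := by
      intro v _
      split_ifs <;> linarith
    split_ifs with h
    · exact Finset.sum_nonneg hnn
    · push Not at h
      obtain ⟨v, hv⟩ := h
      refine le_trans ?_ (Finset.single_le_sum hnn (Finset.mem_univ v))
      rw [abs_neg, habs]
      rcases lt_abs.1 hv with h | h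
      · rw [if_pos (by nlinarith)]
        split_ifs <;> linarith
      · rw [if_pos (c := l * r ≤ -l * _) (by nlinarith)]
        split_ifs <;> linarith
  refine (Finset.sum_le_sum fun G _ => key G).trans ?_
  rw [Finset.sum_comm]
  have : ∀ v : Fin n, ∑ G : SimpleGraph (Fin n),
      ((if |l| * r ≤ l * ((deg G v : ℝ) - n * p) then gnpWeight n p G else 0) +
        (if |(-l)| * r ≤ (-l) * ((deg G v : ℝ) - n * p) then gnpWeight n p G else 0)) ≤
      2 * Real.exp (1 + l ^ 2 * (n * p * (1 - p)) - l * r) := by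
    intro v
    rw [Finset.sum_add_distrib]
    have a := sum_gnpWeight_deg_tail (r := r) h0 h1 (l := l) (by rwa [habs]) v
    have b := sum_gnpWeight_deg_tail (r := r) h0 h1 (l := -l) (by rwa [abs_neg, habs]) v
    rw [neg_sq] at b
    rw [habs] at a
    rw [abs_neg, habs] at b ⊢
    linarith
  refine (Finset.sum_le_sum fun v _ => this v).trans (le_of_eq ?_)
  simp
  ring


/-- Replace the edge `xy` by the edge `wy`. -/
def switchEdge {V : Type} (G : SimpleGraph V) (x y w : V) : SimpleGraph V :=
  G.deleteEdges {s(x, y)} ⊔ SimpleGraph.edge w y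

/-- The edge `xy` may be replaced by the non-edge `wy`. -/
def CanSwitch {V : Type} (G : SimpleGraph V) (x y w : V) : Prop :=
  G.Adj x y ∧ ¬ G.Adj w y ∧ w ≠ x ∧ w ≠ y

section switch

variable {V : Type} {G : SimpleGraph V} {x y w : V}

lemma switchEdge_adj (a b : V) :
    (switchEdge G x y w).Adj a b ↔ (G.Adj a b ∧ ¬ s(a, b) = s(x, y)) ∨ (s(a, b) = s(w, y) ∧ a ≠ b) := by
  simp only [switchEdge, SimpleGraph.sup_adj, SimpleGraph.deleteEdges_adj, SimpleGraph.edge_adj,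
    Set.mem_singleton_iff, Sym2.eq_iff]

lemma CanSwitch.symm (h : CanSwitch G x y w) : CanSwitch (switchEdge G x y w) w y x := by
  obtain ⟨h1, h2, h3, h4⟩ := h
  have := h1.ne
  simp only [CanSwitch, switchEdge_adj, Sym2.eq_iff]
  grind

lemma CanSwitch.switchEdge_switchEdge (h : CanSwitch G x y w) :
    switchEdge (switchEdge G x y w) w y x = G := by
  obtain ⟨h1, h2, h3, h4⟩ := h
  have := h1.ne
  ext a b
  simp only [switchEdge_adj, Sym2.eq_iff]
  have := h1.symm
  have h2' : ¬ G.Adj y w := fun h => h2 h.symm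
  grind

lemma CanSwitch.edgeSet_ncard [Finite V] (h : CanSwitch G x y w) :
    (switchEdge G x y w).edgeSet.ncard = G.edgeSet.ncard := by
  obtain ⟨h1, h2, h3, h4⟩ := h
  have e : (switchEdge G x y w).edgeSet = insert s(w, y) (G.edgeSet \ {s(x, y)}) := by
    ext e
    induction e with
    | _ a b =>
      simp only [SimpleGraph.mem_edgeSet, switchEdge_adj, Set.mem_insert_iff, Set.mem_sdiff,
        Set.mem_singleton_iff, Sym2.eq_iff]
      grind
  rw [e, Set.ncard_insert_of_notMem (by simp [h2]), Set.ncard_sdiff_singleton_add_one (by simpa using h1)]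

lemma CanSwitch.deg_left [Finite V] (h : CanSwitch G x y w) :
    deg (switchEdge G x y w) x + 1 = deg G x := by
  obtain ⟨h1, h2, h3, h4⟩ := h
  have := h1.ne
  have e : (switchEdge G x y w).neighborSet x = G.neighborSet x \ {y} := by
    ext a
    simp only [SimpleGraph.mem_neighborSet, switchEdge_adj, Set.mem_sdiff,
        Set.mem_singleton_iff, Sym2.eq_iff]
    grind
  rw [deg, e, Set.ncard_sdiff_singleton_add_one (by simpa using h1), deg]

lemma CanSwitch.deg_right [Finite V] (h : CanSwitch G x y w) :
    deg (switchEdge G x y w) w = deg G w + 1 := by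
  rw [← h.symm.deg_left, h.switchEdge_switchEdge]

lemma CanSwitch.deg_other [Finite V] (h : CanSwitch G x y w) {v : V} (hx : v ≠ x) (hw : v ≠ w) :
    deg (switchEdge G x y w) v = deg G v := by
  obtain ⟨h1, h2, h3, h4⟩ := h
  have := h1.ne
  by_cases hy : v = y
  · subst hy
    have e : (switchEdge G x v w).neighborSet v = insert w (G.neighborSet v \ {x}) := by
      ext a
      simp only [SimpleGraph.mem_neighborSet, switchEdge_adj, Set.mem_sdiff, Set.mem_insert_iff,
          Set.mem_singleton_iff, Sym2.eq_iff]
      grind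
    rw [deg, e, Set.ncard_insert_of_notMem (by simp [SimpleGraph.adj_comm, h2]),
      Set.ncard_sdiff_singleton_add_one (by simpa using h1.symm), deg]
  · have e : (switchEdge G x y w).neighborSet v = G.neighborSet v := by
      ext a
      simp only [SimpleGraph.mem_neighborSet, switchEdge_adj, Sym2.eq_iff]
      grind
    rw [deg, e, deg]

end switch

/-- The vertex `x` has degree `i` less than `z`, and `z` comes first among the other vertices
ordered by degree and then by label; all degrees are within `r + i` of `μ`. -/
def GapClass {n : ℕ} (μ r : ℝ) (x z : Fin n) (i : ℕ) (G : SimpleGraph (Fin n)) : Prop :=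
  x ≠ z ∧ deg G x + i = deg G z ∧
    (∀ w, w ≠ x → w ≠ z → deg G z < deg G w ∨ deg G z = deg G w ∧ z < w) ∧
    ∀ v, |(deg G v : ℝ) - μ| ≤ r + i

lemma GapClass.switchEdge {n : ℕ} {μ r : ℝ} {x z : Fin n} {i : ℕ} {G : SimpleGraph (Fin n)}
    (hG : GapClass μ r x z i G) {y w : Fin n} (h : CanSwitch G x y w) (hw : w ≠ z) :
    GapClass μ r x z (i + 1) (switchEdge G x y w) := by
  obtain ⟨hxz, hi, hz, hd⟩ := hG
  have hwx := h.2.2.1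
  have ez := h.deg_other hxz.symm hw.symm
  have ex := h.deg_left
  have ew := h.deg_right
  refine ⟨hxz, by omega, fun v hvx hvz => ?_, fun v => ?_⟩
  · rw [ez]
    by_cases hvw : v = w
    · subst hvw
      have := hz v hvx hvz
      left; omega
    · rw [h.deg_other hvx hvw]
      exact hz v hvx hvz
  · have hv := abs_le.1 (hd v)
    rw [abs_le]
    push_cast
    by_cases hvx : v = x
    · subst hvx
      have : (deg (EDHC.switchEdge G v y w) v : ℝ) + 1 = deg G v := by exact_mod_cast ex
      constructor <;> linarith
    · by_cases hvw : v = w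
      · subst hvw
        rw [ew]
        push_cast
        constructor <;> linarith
      · rw [h.deg_other hvx hvw]
        constructor <;> linarith

/-- In a graph all of whose degrees are at most `D` there are many ways to switch an edge
away from `x`. -/
lemma card_canSwitch_ge {n : ℕ} (G : SimpleGraph (Fin n)) (x z : Fin n) {D : ℝ}
    (hD : ∀ v, (deg G v : ℝ) ≤ D) :
    (deg G x : ℝ) * (n - 2 - D) ≤
      ∑ y : Fin n, ∑ w : Fin n, if CanSwitch G x y w ∧ w ≠ z then (1 : ℝ) else 0 := by
  have e : (deg G x : ℝ) * (n - 2 - D) = ∑ y : Fin n, if G.Adj x y then (n - 2 - D : ℝ) else 0 := by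
    rw [← Finset.sum_filter, Finset.sum_const, nsmul_eq_mul, deg_eq_degree, SimpleGraph.degree,
      SimpleGraph.neighborFinset_eq_filter]
  rw [e]
  refine Finset.sum_le_sum fun y _ => ?_
  split_ifs with h
  · rw [← Finset.sum_filter, Finset.sum_const, nsmul_eq_mul, mul_one]
    refine le_of_le_of_eq
      (b := ((Finset.univ.filter fun w => CanSwitch G x y w ∧ w ≠ z).card : ℝ)) ?_ (by congr!)
    have hsub : (Finset.univ : Finset (Fin n)) ⊆
        (Finset.univ.filter fun w => CanSwitch G x y w ∧ w ≠ z) ∪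
          (G.neighborFinset y ∪ {y, z}) := by
      intro w _
      simp only [Finset.mem_union, Finset.mem_filter, Finset.mem_univ, true_and,
        SimpleGraph.mem_neighborFinset, Finset.mem_insert, Finset.mem_singleton]
      unfold CanSwitch
      have := G.adj_comm y w
      have := h.symm
      grind
    have hc := (Finset.card_le_card hsub).trans (Finset.card_union_le _ _)
    have hc2 := Finset.card_union_le (G.neighborFinset y) {y, z}
    have hc3 : ({y, z} : Finset (Fin n)).card ≤ 2 := Finset.card_le_two
    rw [SimpleGraph.card_neighborFinset_eq_degree, ← deg_eq_degree] at hc2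
    rw [Finset.card_univ, Fintype.card_fin] at hc
    have := hD y
    have h4 : n ≤ (Finset.univ.filter fun w => CanSwitch G x y w ∧ w ≠ z).card + (deg G y + 2) := by
      omega
    have h5 := (Nat.cast_le (α := ℝ)).2 h4
    push_cast at h5
    linarith
  · exact Finset.sum_nonneg fun w _ => by split_ifs <;> norm_num

lemma card_canSwitch_le {n : ℕ} (G : SimpleGraph (Fin n)) (x : Fin n) {D : ℝ}
    (hD : ∀ v, (deg G v : ℝ) ≤ D) :
    ∑ y : Fin n, ∑ w : Fin n, (if CanSwitch G w y x then (1 : ℝ) else 0) ≤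
      (n - deg G x) * D := by
  have e : ((n : ℝ) - deg G x) * D = ∑ y : Fin n, if G.Adj x y then (0 : ℝ) else D := by
    have h1 : ∀ y, (if G.Adj x y then (0 : ℝ) else D) = D - if G.Adj x y then D else 0 := by
      intro y; split_ifs <;> ring
    simp_rw [h1]
    rw [Finset.sum_sub_distrib, ← Finset.sum_filter, Finset.sum_const, Finset.sum_const,
      nsmul_eq_mul, nsmul_eq_mul, deg_eq_degree, SimpleGraph.degree,
      SimpleGraph.neighborFinset_eq_filter, Finset.card_univ, Fintype.card_fin, sub_mul]
  rw [e]
  refine Finset.sum_le_sum fun y _ => ?_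
  split_ifs with h
  · exact (Finset.sum_eq_zero fun w _ => if_neg fun hc => hc.2.1 h).le
  · refine le_trans ?_ (hD y)
    rw [← Finset.sum_filter, Finset.sum_const, nsmul_eq_mul, mul_one, deg_eq_degree,
      SimpleGraph.degree]
    gcongr
    intro w
    simp only [Finset.mem_filter, Finset.mem_univ, true_and, SimpleGraph.mem_neighborFinset]
    exact fun h => h.1.symm

/-- Total weight of the graphs in a gap class. -/
noncomputable def gapMass {n : ℕ} (p μ r : ℝ) (x z : Fin n) (i : ℕ) : ℝ :=
  ∑ G : SimpleGraph (Fin n), if GapClass μ r x z i G then gnpWeight n p G else 0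

lemma gapMass_nonneg {n : ℕ} {p : ℝ} (h0 : 0 ≤ p) (h1 : p ≤ 1) (μ r : ℝ) (x z : Fin n) (i : ℕ) :
    0 ≤ gapMass p μ r x z i :=
  Finset.sum_nonneg fun G _ => by
    split_ifs
    exacts [gnpWeight_nonneg h0 h1 G, le_rfl]

lemma gapMass_step {n : ℕ} {p μ r R : ℝ} (h0 : 0 ≤ p) (h1 : p ≤ 1) (x z : Fin n) (i : ℕ)
    (hR : r + (i + 1 : ℕ) ≤ R) (ha : R ≤ μ) (hb : R ≤ n - μ - 2) :
    gapMass p μ r x z i * ((μ - R) * (n - μ - 2 - R)) ≤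
      gapMass p μ r x z (i + 1) * ((n - μ + R) * (μ + R)) := by
  push_cast at hR
  calc gapMass p μ r x z i * ((μ - R) * (n - μ - 2 - R))
      ≤ ∑ G : SimpleGraph (Fin n), ∑ y : Fin n, ∑ w : Fin n,
          if GapClass μ r x z i G ∧ CanSwitch G x y w ∧ w ≠ z then gnpWeight n p G else 0 := by
        rw [gapMass, Finset.sum_mul]
        refine Finset.sum_le_sum fun G _ => ?_
        by_cases hG : GapClass μ r x z i G
        · have hd := fun v => abs_le.1 (hG.2.2.2 v)
          have hc := card_canSwitch_ge G x z (D := μ + R) fun v => by linarith [(hd v).2]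
          have hw := gnpWeight_nonneg h0 h1 G
          simp only [hG, true_and, if_true]
          have : ∀ y w, (if CanSwitch G x y w ∧ w ≠ z then gnpWeight n p G else 0) =
            gnpWeight n p G * if CanSwitch G x y w ∧ w ≠ z then (1 : ℝ) else 0 := by
            intro y w; split_ifs <;> simp
          simp_rw [this, ← Finset.mul_sum]
          refine mul_le_mul_of_nonneg_left (le_trans ?_ hc) hw
          have := (hd x).1
          refine mul_le_mul ?_ ?_ ?_ ?_ <;> linarith
        · simp [hG]
    _ = ∑ y : Fin n, ∑ w : Fin n, ∑ G : SimpleGraph (Fin n),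
          if GapClass μ r x z i G ∧ CanSwitch G x y w ∧ w ≠ z then gnpWeight n p G else 0 := by
        rw [Finset.sum_comm]
        exact Finset.sum_congr rfl fun y _ => Finset.sum_comm
    _ ≤ ∑ y : Fin n, ∑ w : Fin n, ∑ G : SimpleGraph (Fin n),
          if GapClass μ r x z (i + 1) G ∧ CanSwitch G w y x then gnpWeight n p G else 0 := by
        refine Finset.sum_le_sum fun y _ => Finset.sum_le_sum fun w _ => ?_
        rw [← Finset.sum_filter, ← Finset.sum_filter]
        have hinj : Set.InjOn (fun G : SimpleGraph (Fin n) => switchEdge G x y w)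
            (Finset.univ.filter fun G => GapClass μ r x z i G ∧ CanSwitch G x y w ∧ w ≠ z :
              Finset (SimpleGraph (Fin n))) := by
          intro G hG H hH hGH
          simp only [Finset.coe_filter, Finset.mem_univ, true_and, Set.mem_ofPred_eq] at hG hH
          rw [← hG.2.1.switchEdge_switchEdge, ← hH.2.1.switchEdge_switchEdge]
          exact congrArg (fun G => switchEdge G w y x) hGH
        have himg := Finset.sum_image (f := gnpWeight n p) hinj
        have hw : ∀ G ∈ (Finset.univ.filter fun G => GapClass μ r x z i G ∧ CanSwitch G x y w ∧ w ≠ z :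
              Finset (SimpleGraph (Fin n))),
            gnpWeight n p G = gnpWeight n p (switchEdge G x y w) := by
          intro G hG
          simp only [Finset.mem_filter, Finset.mem_univ, true_and] at hG
          rw [gnpWeight, gnpWeight, hG.2.1.edgeSet_ncard]
        rw [Finset.sum_congr rfl hw, ← himg]
        refine Finset.sum_le_sum_of_subset_of_nonneg ?_ fun G _ _ => gnpWeight_nonneg h0 h1 G
        intro G hG
        simp only [Finset.mem_image, Finset.mem_filter, Finset.mem_univ, true_and] at hG ⊢
        obtain ⟨H, ⟨hH, hs, hz⟩, rfl⟩ := hG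
        exact ⟨hH.switchEdge hs hz, hs.symm⟩
    _ = ∑ G : SimpleGraph (Fin n), ∑ y : Fin n, ∑ w : Fin n,
          if GapClass μ r x z (i + 1) G ∧ CanSwitch G w y x then gnpWeight n p G else 0 := by
        rw [Finset.sum_comm (s := (Finset.univ : Finset (SimpleGraph (Fin n))))]
        exact Finset.sum_congr rfl fun y _ => Finset.sum_comm
    _ ≤ _ := by
        rw [gapMass, Finset.sum_mul]
        refine Finset.sum_le_sum fun G _ => ?_
        by_cases hG : GapClass μ r x z (i + 1) G
        · have hd := fun v => abs_le.1 (hG.2.2.2 v)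
          push_cast at hd
          have hc := card_canSwitch_le G x (D := μ + R) fun v => by linarith [(hd v).2]
          have hw := gnpWeight_nonneg h0 h1 G
          simp only [hG, true_and, if_true]
          have : ∀ y w, (if CanSwitch G w y x then gnpWeight n p G else 0) =
            gnpWeight n p G * if CanSwitch G w y x then (1 : ℝ) else 0 := by
            intro y w; split_ifs <;> simp
          simp_rw [this, ← Finset.mul_sum]
          refine mul_le_mul_of_nonneg_left (hc.trans ?_) hw
          have h2 := (hd x).1
          have h3 : 0 ≤ μ + R := le_trans (Nat.cast_nonneg _)
            (by linarith [(hd x).2] : (deg G x : ℝ) ≤ μ + R)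
          refine mul_le_mul_of_nonneg_right ?_ h3
          linarith
        · simp [hG]


lemma minDeg_le {V : Type} (G : SimpleGraph V) (v : V) : minDeg G ≤ deg G v :=
  Nat.sInf_le ⟨v, rfl⟩

lemma stronglyTwoJumping_of_gap {n : ℕ} {G : SimpleGraph (Fin n)} (x : Fin n)
    (h : ∀ w, w ≠ x → (deg G x : ℝ) + 2 * Real.log n ^ 2 ≤ deg G w) :
    StronglyTwoJumping n G := by
  intro T hT
  have hcard : T.ncard = (Set.toFinite T).toFinset.card := Set.ncard_eq_toFinset_card T
  have hpos : 0 < T.ncard := (Set.ncard_pos).2 hT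
  set u := Real.log n ^ 2 with hu
  have hu0 : 0 ≤ u := sq_nonneg _
  set S := (Set.toFinite T).toFinset
  have hmin : ∀ v, (minDeg G : ℝ) ≤ deg G v := fun v => by exact_mod_cast minDeg_le G v
  have hsum : (T.ncard : ℝ) * (minDeg G + 2 * u) - 2 * u ≤ ∑ v ∈ S, (deg G v : ℝ) := by
    have h1 : ∑ v ∈ S, ((minDeg G + 2 * u : ℝ) - if v = x then 2 * u else 0) ≤
        ∑ v ∈ S, (deg G v : ℝ) := by
      refine Finset.sum_le_sum fun v _ => ?_
      split_ifs with hv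
      · linarith [hmin v]
      · linarith [hmin x, h v hv]
    refine le_trans ?_ h1
    rw [Finset.sum_sub_distrib, Finset.sum_const, nsmul_eq_mul, ← hcard, Finset.sum_ite_eq']
    split_ifs <;> linarith
  have ht : (0 : ℝ) < T.ncard := by exact_mod_cast hpos
  rw [ge_iff_le, le_div_iff₀ ht]
  rcases Nat.lt_or_ge 1 T.ncard with h1 | h1
  · have h2 : (2 : ℝ) ≤ T.ncard := by exact_mod_cast h1
    have := min_le_right ((T.ncard : ℝ) - 1) u
    nlinarith
  · have h2 : T.ncard = 1 := by omega
    have := min_le_left ((T.ncard : ℝ) - 1) u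
    have h3 : (minDeg G : ℝ) ≤ ∑ v ∈ S, (deg G v : ℝ) := by
      obtain ⟨v, hv⟩ := hT
      exact (hmin v).trans (Finset.single_le_sum (f := fun v => (deg G v : ℝ))
        (fun _ _ => Nat.cast_nonneg _) ((Set.Finite.mem_toFinset _).2 hv))
    rw [h2] at this ⊢
    push_cast at this ⊢
    linarith

lemma exists_gapClass {n : ℕ} (hn : 2 ≤ n) {μ r : ℝ} {g : ℕ} (hg : 2 * Real.log n ^ 2 ≤ g)
    {G : SimpleGraph (Fin n)} (hd : ∀ v, |(deg G v : ℝ) - μ| ≤ r)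
    (hG : ¬ StronglyTwoJumping n G) :
    ∃ x z, ∃ i < g, GapClass μ r x z i G := by
  obtain ⟨x, -, hx⟩ := Finset.exists_min_image (Finset.univ : Finset (Fin n)) (deg G)
    ⟨⟨0, by omega⟩, Finset.mem_univ _⟩
  have hne : (Finset.univ.erase x).Nonempty := by
    rw [← Finset.card_pos, Finset.card_erase_of_mem (Finset.mem_univ _), Finset.card_univ,
      Fintype.card_fin]
    omega
  obtain ⟨z, hz, hzm⟩ := Finset.exists_min_image (Finset.univ.erase x)
    (fun w => toLex (deg G w, w)) hne
  have hzx : z ≠ x := (Finset.mem_erase.1 hz).1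
  have hlex : ∀ w, w ≠ x → w ≠ z → deg G z < deg G w ∨ deg G z = deg G w ∧ z < w := by
    intro w hwx hwz
    have := hzm w (Finset.mem_erase.2 ⟨hwx, Finset.mem_univ _⟩)
    rw [Prod.Lex.toLex_le_toLex] at this
    rcases this with h | ⟨h, h'⟩
    · exact Or.inl h
    · exact Or.inr ⟨h, lt_of_le_of_ne h' hwz.symm⟩
  have hxz := hx z (Finset.mem_univ _)
  refine ⟨x, z, deg G z - deg G x, ?_, hzx.symm, by omega, hlex, fun v => (hd v).trans (by simp)⟩
  by_contra hlt
  push Not at hlt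
  refine hG (stronglyTwoJumping_of_gap x fun w hw => ?_)
  have hzw : deg G z ≤ deg G w := by
    by_cases h : w = z
    · rw [h]
    · rcases hlex w hw h with h | h <;> omega
  have : (deg G x : ℝ) + g ≤ deg G w := by exact_mod_cast (by omega : deg G x + g ≤ deg G w)
  linarith

lemma GapClass.unique {n : ℕ} {μ r : ℝ} {x z x' z' : Fin n} {i i' : ℕ} {G : SimpleGraph (Fin n)}
    (h : GapClass μ r x z i G) (h' : GapClass μ r x' z' i' G) (hi : 0 < i) (hi' : 0 < i') :
    x = x' ∧ z = z' ∧ i = i' := by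
  obtain ⟨a1, a2, a3, -⟩ := h
  obtain ⟨b1, b2, b3, -⟩ := h'
  have ha : ∀ w, w ≠ x → deg G x < deg G w := by
    intro w hw
    by_cases hz : w = z
    · subst hz; omega
    · rcases a3 w hw hz with h | h <;> omega
  have hb : ∀ w, w ≠ x' → deg G x' < deg G w := by
    intro w hw
    by_cases hz : w = z'
    · subst hz; omega
    · rcases b3 w hw hz with h | h <;> omega
  have hx : x = x' := by
    by_contra hne
    have := ha x' (Ne.symm hne)
    have := hb x hne
    omega
  subst hx
  have hz : z = z' := by
    by_contra hne
    have h1 := a3 z' b1.symm (Ne.symm hne)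
    have h2 := b3 z a1.symm hne
    omega
  subst hz
  exact ⟨rfl, rfl, by omega⟩

/-- Total weight of the gap classes with gap `i`, over all pairs of vertices. -/
noncomputable def totalGapMass (n : ℕ) (p μ r : ℝ) (i : ℕ) : ℝ :=
  ∑ x : Fin n, ∑ z : Fin n, gapMass p μ r x z i

lemma sum_totalGapMass_le_one {n : ℕ} (hn : 0 < n) {p : ℝ} (h0 : 0 ≤ p) (h1 : p ≤ 1) (μ r : ℝ)
    (s : Finset ℕ) (hs : ∀ i ∈ s, 0 < i) :
    ∑ i ∈ s, totalGapMass n p μ r i ≤ 1 := by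
  have e : ∑ i ∈ s, totalGapMass n p μ r i = ∑ G : SimpleGraph (Fin n),
      ∑ t ∈ s ×ˢ (Finset.univ : Finset (Fin n × Fin n)),
        if GapClass μ r t.2.1 t.2.2 t.1 G then gnpWeight n p G else 0 := by
    rw [Finset.sum_comm, Finset.sum_product]
    simp_rw [Fintype.sum_prod_type]
    rfl
  rw [e, ← sum_gnpWeight hn p]
  refine Finset.sum_le_sum fun G _ => ?_
  rw [← Finset.sum_filter, Finset.sum_const, nsmul_eq_mul]
  refine mul_le_of_le_one_left (gnpWeight_nonneg h0 h1 G) ?_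
  rw [Nat.cast_le_one, Finset.card_le_one]
  rintro ⟨i, x, z⟩ ht ⟨i', x', z'⟩ ht'
  simp only [Finset.mem_filter, Finset.mem_product, Finset.mem_univ, and_true] at ht ht'
  obtain ⟨rfl, rfl, rfl⟩ := ht.2.unique ht'.2 (hs _ ht.1) (hs _ ht'.1)
  rfl

lemma totalGapMass_nonneg {n : ℕ} {p : ℝ} (h0 : 0 ≤ p) (h1 : p ≤ 1) (μ r : ℝ) (i : ℕ) :
    0 ≤ totalGapMass n p μ r i :=
  Finset.sum_nonneg fun _ _ => Finset.sum_nonneg fun _ _ => gapMass_nonneg h0 h1 _ _ _ _ _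

section

variable {n : ℕ} {p μ r R ρ : ℝ}

lemma totalGapMass_step (h0 : 0 ≤ p) (h1 : p ≤ 1) (ha : R < μ) (hb : R < n - μ - 2)
    (hρ : (n - μ + R) * (μ + R) ≤ ρ * ((μ - R) * (n - μ - 2 - R))) {i : ℕ}
    (hR : r + (i + 1 : ℕ) ≤ R) :
    totalGapMass n p μ r i ≤ ρ * totalGapMass n p μ r (i + 1) := by
  simp only [totalGapMass, Finset.mul_sum]
  refine Finset.sum_le_sum fun x _ => Finset.sum_le_sum fun z _ => ?_
  have hF : 0 < (μ - R) * (n - μ - 2 - R) := mul_pos (by linarith) (by linarith)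
  refine le_of_mul_le_mul_right ?_ hF
  refine (gapMass_step h0 h1 x z i hR ha.le hb.le).trans ?_
  have := mul_le_mul_of_nonneg_left hρ (gapMass_nonneg h0 h1 μ r x z (i + 1))
  linarith

lemma totalGapMass_iterate (h0 : 0 ≤ p) (h1 : p ≤ 1) (ha : R < μ) (hb : R < n - μ - 2)
    (hρ1 : 0 ≤ ρ) (hρ : (n - μ + R) * (μ + R) ≤ ρ * ((μ - R) * (n - μ - 2 - R))) (i j : ℕ)
    (hR : r + (i + j : ℕ) ≤ R) :
    totalGapMass n p μ r i ≤ ρ ^ j * totalGapMass n p μ r (i + j) := by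
  induction j with
  | zero => simp
  | succ j ih =>
    push_cast at hR ih
    refine (ih (by linarith)).trans ?_
    rw [pow_succ, mul_assoc]
    refine mul_le_mul_of_nonneg_left ?_ (pow_nonneg hρ1 _)
    exact totalGapMass_step h0 h1 ha hb hρ (by push_cast; linarith)

lemma mul_totalGapMass_le (hn : 0 < n) (h0 : 0 ≤ p) (h1 : p ≤ 1) (ha : R < μ) (hb : R < n - μ - 2)
    (hρ1 : 1 ≤ ρ) (hρ : (n - μ + R) * (μ + R) ≤ ρ * ((μ - R) * (n - μ - 2 - R))) (i K : ℕ)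
    (hR : r + (i + K : ℕ) ≤ R) :
    K * totalGapMass n p μ r i ≤ ρ ^ K := by
  calc K * totalGapMass n p μ r i = ∑ j ∈ Finset.Icc 1 K, totalGapMass n p μ r i := by simp
    _ ≤ ∑ j ∈ Finset.Icc 1 K, ρ ^ K * totalGapMass n p μ r (i + j) := by
        refine Finset.sum_le_sum fun j hj => ?_
        rw [Finset.mem_Icc] at hj
        have : (j : ℝ) ≤ K := by exact_mod_cast hj.2
        refine (totalGapMass_iterate h0 h1 ha hb (by linarith) hρ i j
          (by push_cast at hR ⊢; linarith)).trans ?_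
        exact mul_le_mul_of_nonneg_right (pow_le_pow_right₀ hρ1 hj.2)
          (totalGapMass_nonneg h0 h1 _ _ _)
    _ = ρ ^ K * ∑ j ∈ (Finset.Icc 1 K).image (i + ·), totalGapMass n p μ r j := by
        rw [Finset.sum_image (by simp), Finset.mul_sum]
    _ ≤ ρ ^ K := by
        refine mul_le_of_le_one_right (by positivity) (sum_totalGapMass_le_one hn h0 h1 _ _ _ ?_)
        intro j hj
        simp only [Finset.mem_image, Finset.mem_Icc] at hj
        omega

end

/-- The failure probability is at most the tail of the degrees plus the weight of small gaps. -/
lemma one_sub_gnpProb_le {n : ℕ} (hn : 2 ≤ n) {p r : ℝ} (h0 : 0 ≤ p) (h1 : p ≤ 1) {g : ℕ}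
    (hg : 2 * Real.log n ^ 2 ≤ g) :
    1 - gnpProb n p (StronglyTwoJumping n) ≤
      (∑ G : SimpleGraph (Fin n),
        if ∀ v, |(deg G v : ℝ) - n * p| ≤ r then 0 else gnpWeight n p G) +
      ∑ i ∈ Finset.range g, totalGapMass n p (n * p) r i := by
  have e : ∑ i ∈ Finset.range g, totalGapMass n p (n * p) r i = ∑ G : SimpleGraph (Fin n),
      ∑ t ∈ Finset.range g ×ˢ (Finset.univ : Finset (Fin n × Fin n)),
        if GapClass (n * p) r t.2.1 t.2.2 t.1 G then gnpWeight n p G else 0 := by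
    rw [Finset.sum_comm, Finset.sum_product]
    simp_rw [Fintype.sum_prod_type]
    rfl
  have e2 : gnpProb n p (StronglyTwoJumping n) =
      ∑ G : SimpleGraph (Fin n), if StronglyTwoJumping n G then gnpWeight n p G else 0 := rfl
  rw [e, e2, ← sum_gnpWeight (by omega : 0 < n) p, ← Finset.sum_sub_distrib,
    ← Finset.sum_add_distrib]
  refine Finset.sum_le_sum fun G _ => ?_
  have hw := gnpWeight_nonneg h0 h1 G
  have hnn : ∀ t ∈ Finset.range g ×ˢ (Finset.univ : Finset (Fin n × Fin n)),
      0 ≤ if GapClass (n * p) r t.2.1 t.2.2 t.1 G then gnpWeight n p G else 0 := by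
    intro t _
    split_ifs <;> linarith
  have hs := Finset.sum_nonneg hnn
  by_cases hS : StronglyTwoJumping n G
  · rw [if_pos hS]
    split_ifs <;> linarith
  · rw [if_neg hS]
    by_cases hd : ∀ v, |(deg G v : ℝ) - n * p| ≤ r
    · rw [if_pos hd]
      obtain ⟨x, z, i, hi, hx⟩ := exists_gapClass hn hg hd hS
      have := Finset.single_le_sum hnn (a := (i, x, z)) (by simp [hi])
      rw [if_pos hx] at this
      linarith
    · rw [if_neg hd]
      linarith

lemma switch_ratio_le {a b R : ℝ} (hR : 20 ≤ R) (ha : 10 * R ≤ a) (hb : 10 * R ≤ b) :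
    (b + R) * (a + R) ≤ Real.exp (4 * R / a + 4 * R / b) * ((a - R) * (b - 2 - R)) := by
  have ha0 : 0 < a := by linarith
  have hb0 : 0 < b := by linarith
  have h1 : a + R ≤ (a - R) * Real.exp (4 * R / a) := by
    have := Real.add_one_le_exp (4 * R / a)
    have h2 : R * (R / a) ≤ R * (1 / 10) := by
      refine mul_le_mul_of_nonneg_left ?_ (by linarith)
      rw [div_le_iff₀ ha0]; linarith
    calc a + R ≤ (a - R) * (4 * R / a + 1) := by
          have : (a - R) * (4 * R / a + 1) = a + 3 * R - 4 * (R * (R / a)) := by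
            field_simp; ring
          linarith
      _ ≤ _ := mul_le_mul_of_nonneg_left this (by linarith)
  have h2 : b + R ≤ (b - 2 - R) * Real.exp (4 * R / b) := by
    have := Real.add_one_le_exp (4 * R / b)
    have h2 : (R + 2) * (R / b) ≤ (R + 2) * (1 / 10) := by
      refine mul_le_mul_of_nonneg_left ?_ (by linarith)
      rw [div_le_iff₀ hb0]; linarith
    calc b + R ≤ (b - 2 - R) * (4 * R / b + 1) := by
          have : (b - 2 - R) * (4 * R / b + 1) = b + 3 * R - 2 - 4 * ((R + 2) * (R / b)) := by
            field_simp; ring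
          linarith
      _ ≤ _ := mul_le_mul_of_nonneg_left this (by linarith)
  calc (b + R) * (a + R) ≤ ((b - 2 - R) * Real.exp (4 * R / b)) * ((a - R) * Real.exp (4 * R / a)) := by
        refine mul_le_mul h2 h1 (by linarith) (mul_nonneg (by linarith) (Real.exp_nonneg _))
    _ = _ := by rw [Real.exp_add]; ring

lemma degree_tail_le {L : ℝ} (hL : 10 ≤ L) :
    2 * Real.exp L * Real.exp (1 - 9 / 4 * L) ≤ 1 / L := by
  rw [mul_assoc, ← Real.exp_add, le_div_iff₀ (by linarith)]
  have h3 := Real.quadratic_le_exp_of_nonneg (by linarith : 0 ≤ L)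
  have h4 : Real.exp (L + (1 - 9 / 4 * L)) ≤ Real.exp (-L) := Real.exp_le_exp.2 (by linarith)
  have h5 : Real.exp (-L) * Real.exp L = 1 := by rw [← Real.exp_add]; simp
  have h6 : 2 * L ≤ Real.exp L := by nlinarith
  calc 2 * Real.exp (L + (1 - 9 / 4 * L)) * L = Real.exp (L + (1 - 9 / 4 * L)) * (2 * L) := by ring
    _ ≤ Real.exp (-L) * Real.exp L := by gcongr
    _ = 1 := h5

lemma small_gap_le {L g κ : ℝ} (hL : 10 ≤ L) (hg : g ≤ 2 * L ^ 2 + 1) (hκ : 1.375 * L ^ 3 ≤ κ) :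
    g * (2.7183 / (κ - 1)) ≤ 5 / L := by
  have hL3 : 1000 ≤ L ^ 3 := by
    calc (1000 : ℝ) = 10 ^ 3 := by norm_num
      _ ≤ L ^ 3 := by gcongr
  have hκ1 : 0 < κ - 1 := by linarith
  rw [mul_div_assoc', div_le_div_iff₀ hκ1 (by linarith)]
  have : g * 2.7183 * L ≤ (2 * L ^ 2 + 1) * 2.7183 * L := by gcongr
  nlinarith

/-- The quantitative statement, assuming only that `n * p` and `n * (1 - p)` are not too small. -/
lemma gnpProb_stronglyTwoJumping_ge {n : ℕ} {p : ℝ} (hL : 10 ≤ Real.log n) (h0 : 0 < p) (h1 : p < 1)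
    (ha : 2304 * Real.log n ^ 7 ≤ n * p) (hb : 2304 * Real.log n ^ 7 ≤ n * (1 - p)) :
    1 - 6 / Real.log n ≤ gnpProb n p (StronglyTwoJumping n) := by
  set L := Real.log n with hLdef
  have hn0 : (0 : ℝ) < n := by
    rcases Nat.eq_zero_or_pos n with h | h
    · simp [hLdef, h] at hL; norm_num at hL
    · exact_mod_cast h
  have hnexp : (n : ℝ) = Real.exp L := (Real.exp_log hn0).symm
  have hn2 : 2 ≤ n := by
    have : (2 : ℝ) ≤ n := by rw [hnexp]; linarith [Real.add_one_le_exp L]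
    exact_mod_cast this
  have hq0 : 0 < 1 - p := by linarith
  set V := (n : ℝ) * p * (1 - p) with hV
  have hV0 : 0 < V := by positivity
  have hVL : 1152 * L ^ 7 ≤ V := by
    have : 0 ≤ L ^ 7 := by positivity
    rcases le_total p (1 / 2) with h | h
    · have : 1 / 2 ≤ 1 - p := by linarith
      nlinarith
    · nlinarith
  set t := √L with ht
  set σ := √V with hσ
  have ht2 : t ^ 2 = L := Real.sq_sqrt (by linarith)
  have hσ2 : σ ^ 2 = V := Real.sq_sqrt hV0.le
  have ht3 : 3 ≤ t := Real.le_sqrt_of_sq_le (by linarith)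
  have hσ0 : 0 < σ := Real.sqrt_pos.2 hV0
  clear_value t σ
  have hσt : 33 * t ^ 7 ≤ σ := by
    refine (pow_le_pow_iff_left₀ (by positivity) hσ0.le two_ne_zero).1 ?_
    rw [hσ2]
    have : (33 * t ^ 7) ^ 2 = 1089 * L ^ 7 := by rw [← ht2]; ring
    rw [this]
    have : 0 ≤ L ^ 7 := by positivity
    linarith
  set κ := σ / (24 * t) with hκ
  have hκ0 : 0 < κ := by positivity
  have hκL : 1.375 * L ^ 3 ≤ κ := by
    rw [hκ, le_div_iff₀ (by positivity), ← ht2]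
    linarith [hσt]
  set R := 6 * t * σ with hRdef
  set K := ⌊κ⌋₊ with hK
  set g := ⌈2 * L ^ 2⌉₊ with hg
  have hgle : 2 * L ^ 2 ≤ g := Nat.le_ceil _
  have hgle' : (g : ℝ) ≤ 2 * L ^ 2 + 1 := (Nat.ceil_lt_add_one (by positivity)).le
  have hκ1 : 0 < κ - 1 := by
    have : 10 ^ 3 ≤ L ^ 3 := by gcongr
    linarith
  have hKle : (K : ℝ) ≤ κ := Nat.floor_le hκ0.le
  have hKge : κ - 1 ≤ K := (Nat.sub_one_lt_floor κ).le
  clear_value g K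
  have hσκ : σ = 24 * t * κ := by rw [hκ]; field_simp
  have hR2 : R = 2 * (3 * t * σ) := by rw [hRdef]; ring
  have hgκ : (g : ℝ) ≤ κ := by nlinarith
  have hκR : 2 * κ ≤ 3 * t * σ := by
    rw [hσκ]
    nlinarith [mul_pos hκ0 hκ0]
  have hR20 : 20 ≤ R := by
    have : 1 ≤ t ^ 7 := one_le_pow₀ (by linarith)
    rw [hRdef]; nlinarith
  have hsmall : ∀ c : ℝ, 2304 * L ^ 7 ≤ c → V ≤ c → 10 * R ≤ c := by
    intro c hc hVc
    refine abs_le_of_sq_le_sq' ?_ (by linarith) |>.2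
    have : (10 * R) ^ 2 = 3600 * L * V := by rw [hRdef, ← ht2, ← hσ2]; ring
    rw [this, sq]
    have hL77 : 10 * L ≤ L ^ 7 := by
      calc 10 * L ≤ L * L := by nlinarith
        _ = L ^ 2 := by ring
        _ ≤ L ^ 7 := pow_le_pow_right₀ (by linarith) (by norm_num)
    exact mul_le_mul (by linarith) hVc hV0.le (by linarith)
  have haR := hsmall _ ha (mul_le_of_le_one_right (by positivity) (by linarith))
  have hbR := hsmall _ hb (by
    rw [hV, mul_right_comm]
    exact mul_le_of_le_one_right (by positivity) h1.le)
  have hρ := switch_ratio_le hR20 haR hbR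
  have hexp : 4 * R / (n * p) + 4 * R / (n * (1 - p)) = 1 / κ := by
    have : 4 * R / (n * p) + 4 * R / (n * (1 - p)) = 4 * R / V := by
      rw [hV]; field_simp; ring
    rw [this, ← hσ2, hRdef, hκ]
    field_simp
    ring
  rw [hexp] at hρ
  have hnq : (n : ℝ) * (1 - p) = n - n * p := by ring
  rw [hnq] at hρ hbR
  have htail := sum_gnpWeight_deg_far (n := n) (p := p) (l := 3 * t / (2 * σ)) (r := 3 * t * σ)
    h0.le h1.le (by positivity) (by
      rw [div_le_one (by positivity)]
      have : t ≤ t ^ 7 := le_self_pow₀ (by linarith) (by norm_num)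
      linarith)
  have htail2 : 2 * (n : ℝ) * Real.exp (1 + (3 * t / (2 * σ)) ^ 2 * (n * p * (1 - p)) -
      3 * t / (2 * σ) * (3 * t * σ)) ≤ 1 / L := by
    have : 1 + (3 * t / (2 * σ)) ^ 2 * (n * p * (1 - p)) -
      3 * t / (2 * σ) * (3 * t * σ) = 1 - 9 / 4 * L := by
      rw [← hV, ← hσ2, ← ht2]; field_simp; ring
    rw [this, hnexp]
    exact degree_tail_le hL
  have hgap : ∀ i ∈ Finset.range g,
      totalGapMass n p (n * p) (3 * t * σ) i ≤ 2.7183 / (κ - 1) := by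
    intro i hi
    have hig : (i : ℝ) ≤ g := by exact_mod_cast (Finset.mem_range.1 hi).le
    have hm := mul_totalGapMass_le (n := n) (p := p) (μ := n * p) (r := 3 * t * σ) (R := R)
      (by omega) h0.le h1.le (by linarith) (by linarith)
      (Real.one_le_exp (by positivity)) hρ i K (by
        push_cast
        linarith)
    have he : Real.exp (1 / κ) ^ K ≤ 2.7183 := by
      rw [← Real.exp_nat_mul]
      refine (Real.exp_le_exp.2 (?_ : _ ≤ (1 : ℝ))).trans (by linarith [Real.exp_one_lt_d9])
      rw [mul_one_div, div_le_one hκ0]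
      exact hKle
    have hnn := totalGapMass_nonneg (n := n) h0.le h1.le (n * p) (3 * t * σ) i
    rw [le_div_iff₀ hκ1]
    have := mul_le_mul_of_nonneg_left hKge hnn
    linarith
  have hsum := Finset.sum_le_sum hgap
  rw [Finset.sum_const, Finset.card_range, nsmul_eq_mul] at hsum
  have hfin := small_gap_le hL hgle' hκL
  have := one_sub_gnpProb_le hn2 (r := 3 * t * σ) h0.le h1.le hgle
  have h6 : 6 / L = 1 / L + 5 / L := by ring
  linarith

end EDHC

open EDHC in
/-- Lemma 4.7: whp `G_{n,p}` is strongly 2-jumping. -/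
theorem stmt_7 :
    ∃ N : ℕ, ∀ n : ℕ, N ≤ n → ∀ p : ℝ,
      48 ^ 2 * (Real.log n) ^ 7 / n ≤ p →
      p ≤ 1 - 36 * (n : ℝ) ^ (-(1 / 2 : ℝ)) * (Real.log n) ^ (7 / 2 : ℝ) →
      1 - 6 / Real.log n ≤ gnpProb n p (fun G => StronglyTwoJumping n G) := by
  have hlog : Filter.Tendsto (fun n : ℕ => Real.log n) Filter.atTop Filter.atTop :=
    Real.tendsto_log_atTop.comp tendsto_natCast_atTop_atTop
  have hev : ∀ᶠ n : ℕ in Filter.atTop, 10 ≤ Real.log n ∧ 4096 * Real.log n ^ 7 ≤ n := by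
    have h := (Real.isLittleO_pow_log_id_atTop (n := 7)).comp_tendsto
      (tendsto_natCast_atTop_atTop (R := ℝ))
    filter_upwards [hlog.eventually_ge_atTop 10, h.bound (by norm_num : (0 : ℝ) < 1 / 4096)]
      with n h1 h2
    refine ⟨h1, ?_⟩
    simp only [Function.comp_apply, id_eq, Real.norm_eq_abs, Nat.abs_cast] at h2
    rw [abs_of_nonneg (by positivity)] at h2
    linarith
  obtain ⟨N, hN⟩ := Filter.eventually_atTop.1 hev
  refine ⟨N, fun n hn p hp1 hp2 => ?_⟩
  obtain ⟨hL, hnL⟩ := hN n hn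
  have hL7 : 0 < Real.log n ^ 7 := by positivity
  have hn0 : (0 : ℝ) < n := by linarith
  have hp0 : 0 < p := lt_of_lt_of_le (by positivity) hp1
  have hq0 : 0 < 36 * (n : ℝ) ^ (-(1 / 2 : ℝ)) * (Real.log n) ^ (7 / 2 : ℝ) := by positivity
  refine gnpProb_stronglyTwoJumping_ge hL hp0 (by linarith) ?_ ?_
  · rw [div_le_iff₀ hn0] at hp1
    linarith
  · set s := (Real.log n) ^ (7 / 2 : ℝ) with hs
    have hs2 : s ^ 2 = Real.log n ^ 7 := by
      rw [hs, ← Real.rpow_natCast, ← Real.rpow_mul (by linarith), ← Real.rpow_natCast]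
      norm_num
    have hs0 : 0 < s := by positivity
    have hns : 64 * s ≤ √n := Real.le_sqrt_of_sq_le (by nlinarith)
    have hnn : (n : ℝ) * (n : ℝ) ^ (-(1 / 2 : ℝ)) = √n := by
      rw [Real.sqrt_eq_rpow, ← Real.rpow_one_add' hn0.le (by norm_num)]
      norm_num
    calc 2304 * Real.log n ^ 7 = 36 * (64 * s) * s := by rw [← hs2]; ring
      _ ≤ 36 * √n * s := by gcongr
      _ = n * (36 * (n : ℝ) ^ (-(1 / 2 : ℝ)) * s) := by rw [← hnn]; ring
      _ ≤ n * (1 - p) := by gcongr; linarith
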